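/- There exists a subspace S of A_n^{t_n}(d) which is a two-sided ideal of A_n^{t_n}(d), such that A_n^{t_n}(d) is the internal direct sum M ⊕ S (i.e. M + S = A_n^{t_n}(d) and M ∩ S = {0}), and m·s = 0 = s·m for all m ∈ M and s ∈ S. -/

import Mathlib

/-- The permutation operator `V(σ)` on `(ℂ^d)^{⊗ n}`, realized as the square matrix
indexed by functions `f g : Fin n → Fin d`, with entry `1` if `g = f ∘ σ` and `0` otherwise. -/
noncomputable def V (n d : ℕ) (σ : Equiv.Perm (Fin n)) :
    Matrix (Fin n → Fin d) (Fin n → Fin d) ℂ :=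
  Matrix.of fun f g => if g = f ∘ σ then 1 else 0

/-- Partial transpose of a matrix on `(ℂ^d)^{⊗ n}` at position `p`. -/
noncomputable def pt {n d : ℕ} (p : Fin n)
    (A : Matrix (Fin n → Fin d) (Fin n → Fin d) ℂ) :
    Matrix (Fin n → Fin d) (Fin n → Fin d) ℂ :=
  Matrix.of fun f g =>
    A (Function.update f p (g p)) (Function.update g p (f p))

/-- The last position `n` of the tensor product, as an element of `Fin n`. -/
def lastIdx (n : ℕ) (hn : 1 ≤ n) : Fin n := ⟨n - 1, by omega⟩
/-- The algebra `A_n^{t_n}(d)`: the `ℂ`-linear span of `{V(σ)^{t_n} : σ ∈ S(n)}`. -/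
noncomputable def Aspan (n d : ℕ) (hn : 1 ≤ n) :
    Submodule ℂ (Matrix (Fin n → Fin d) (Fin n → Fin d) ℂ) :=
  Submodule.span ℂ (Set.range fun σ : Equiv.Perm (Fin n) => pt (lastIdx n hn) (V n d σ))

/-- The ideal `M`: the `ℂ`-linear span of `{V(σ)^{t_n} : σ ∈ S(n), σ(n) ≠ n}`. -/
noncomputable def Mid (n d : ℕ) (hn : 1 ≤ n) :
    Submodule ℂ (Matrix (Fin n → Fin d) (Fin n → Fin d) ℂ) :=
  Submodule.span ℂ
    {x | ∃ σ : Equiv.Perm (Fin n), σ (lastIdx n hn) ≠ lastIdx n hn ∧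
      x = pt (lastIdx n hn) (V n d σ)}

section PartialTranspose

variable {n d : ℕ}

theorem pt_V_apply (p : Fin n) (σ : Equiv.Perm (Fin n)) (f g : Fin n → Fin d) :
    pt p (V n d σ) f g =
      if Function.update g p (f p) = Function.update f p (g p) ∘ σ then 1 else 0 := rfl

theorem update_comp_perm {p : Fin n} {α : Equiv.Perm (Fin n)} (hα : α p = p)
    (f : Fin n → Fin d) (a : Fin d) :
    Function.update f p a ∘ α = Function.update (f ∘ α) p a := by
  have h := Function.update_comp_equiv f α p a
  rwa [(Equiv.symm_apply_eq α).2 hα.symm] at h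

theorem V_mul_apply (σ : Equiv.Perm (Fin n)) (X : Matrix (Fin n → Fin d) (Fin n → Fin d) ℂ)
    (f g : Fin n → Fin d) : (V n d σ * X) f g = X (f ∘ σ) g := by
  simp [Matrix.mul_apply, V]

theorem mul_V_apply (σ : Equiv.Perm (Fin n)) (X : Matrix (Fin n → Fin d) (Fin n → Fin d) ℂ)
    (f g : Fin n → Fin d) : (X * V n d σ) f g = X f (g ∘ σ.symm) := by
  simp [Matrix.mul_apply, V, ← Equiv.comp_symm_eq]

theorem pt_V_mul_of_fixed_left {p : Fin n} {α : Equiv.Perm (Fin n)} (hα : α p = p)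
    (τ : Equiv.Perm (Fin n)) : pt p (V n d (α * τ)) = V n d α * pt p (V n d τ) := by
  ext f g
  rw [V_mul_apply, pt_V_apply, pt_V_apply, ← update_comp_perm hα, Function.comp_apply, hα]
  rfl

theorem pt_V_mul_of_fixed_right {p : Fin n} {β : Equiv.Perm (Fin n)} (hβ : β p = p)
    (τ : Equiv.Perm (Fin n)) : pt p (V n d (τ * β)) = pt p (V n d τ) * V n d β := by
  ext f g
  have hβ' : β.symm p = p := (Equiv.symm_apply_eq β).2 hβ.symm
  rw [mul_V_apply, pt_V_apply, pt_V_apply, ← update_comp_perm hβ', Function.comp_apply, hβ']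
  congr 1
  exact propext (Equiv.comp_symm_eq β (Function.update f p (g p) ∘ τ) _).symm

theorem pt_V_of_fixed {p : Fin n} {α : Equiv.Perm (Fin n)} (hα : α p = p) :
    pt p (V n d α) = V n d α := by
  ext f g
  rw [pt_V_apply, update_comp_perm hα]
  change _ = if g = f ∘ α then (1 : ℂ) else 0
  congr 1
  refine propext ⟨fun h => ?_, fun h => ?_⟩
  · funext i
    by_cases hi : i = p
    · have := congrFun h p
      simp only [Function.update_self] at this
      rw [hi, Function.comp_apply, hα, this]
    · simpa [hi] using congrFun h i
  · subst h
    simp [hα]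

theorem conjTranspose_pt_V (p : Fin n) (σ : Equiv.Perm (Fin n)) :
    (pt p (V n d σ)).conjTranspose = pt p (V n d σ⁻¹) := by
  ext f g
  rw [Matrix.conjTranspose_apply, pt_V_apply, pt_V_apply, apply_ite star, star_one, star_zero]
  congr 1
  exact propext ((Equiv.comp_symm_eq σ _ _).symm.trans eq_comm)

theorem pt_V_swap_apply {p q : Fin n} (hq : q ≠ p) (f g : Fin n → Fin d) :
    pt p (V n d (Equiv.swap p q)) f g =
      if f p = f q ∧ g p = g q ∧ ∀ i, i ≠ p → i ≠ q → g i = f i then 1 else 0 := by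
  rw [pt_V_apply]
  congr 1
  refine propext ⟨fun h => ⟨?_, ?_, fun i hp hi => ?_⟩, fun ⟨h₁, h₂, h₃⟩ => ?_⟩
  · simpa [hq] using congrFun h p
  · simpa [hq, eq_comm] using congrFun h q
  · simpa [hp, hi, Equiv.swap_apply_of_ne_of_ne] using congrFun h i
  · funext i
    by_cases hp : i = p
    · subst hp; simp [hq, h₁]
    by_cases hi : i = q
    · subst hi; simp [hq, h₂]
    simp [hp, hi, Equiv.swap_apply_of_ne_of_ne, h₃ i hp hi]

theorem pt_V_swap_mul_self {p q : Fin n} (hq : q ≠ p) :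
    pt p (V n d (Equiv.swap p q)) * pt p (V n d (Equiv.swap p q)) =
      (d : ℂ) • pt p (V n d (Equiv.swap p q)) := by
  ext f g
  rw [Matrix.smul_apply, Matrix.mul_apply]
  simp only [pt_V_swap_apply hq]
  let φ : Fin d → Fin n → Fin d := fun a => Function.update (Function.update f q a) p a
  have hφ : Function.Injective φ := fun a b h => by simpa [φ] using congrFun h p
  rw [← Finset.sum_subset (Finset.subset_univ (Finset.univ.map ⟨φ, hφ⟩)), Finset.sum_map]
  · rw [Finset.sum_congr rfl (g := fun _ =>
      if f p = f q ∧ g p = g q ∧ ∀ i, i ≠ p → i ≠ q → g i = f i then (1 : ℂ) else 0)]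
    · simp
    · intro a _
      simp only [Function.Embedding.coeFn_mk, ← ite_and, ite_mul, one_mul, zero_mul]
      congr 1
      simp +contextual [φ, hq]
  · intro h _ hh
    rw [if_neg, zero_mul]
    rintro ⟨-, h₂, h₃⟩
    refine hh (Finset.mem_map.2 ⟨h p, Finset.mem_univ _, ?_⟩)
    funext i
    by_cases hp : i = p
    · subst hp; simp [φ]
    by_cases hi : i = q
    · subst hi; simp [φ, hp, h₂]
    simp [φ, hp, hi, h₃ i hp hi]

theorem pt_V_swap_mul_swap {p q r : Fin n} (hq : q ≠ p) (hr : r ≠ p) (hqr : q ≠ r) :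
    pt p (V n d (Equiv.swap p q)) * pt p (V n d (Equiv.swap p r)) =
      pt p (V n d (Equiv.swap p q)) * V n d (Equiv.swap q r) := by
  ext f g
  rw [mul_V_apply, Matrix.mul_apply]
  simp only [pt_V_swap_apply hq, pt_V_swap_apply hr]
  rw [Finset.sum_eq_single (Function.update (Function.update f q (f r)) p (f r))]
  · simp only [ite_mul, one_mul, zero_mul, ← ite_and]
    congr 1
    have hs : Equiv.swap q r p = p := Equiv.swap_apply_of_ne_of_ne hq.symm hr.symm
    refine propext ⟨fun ⟨⟨h₁, _, _⟩, _, h₂, h₃⟩ => ⟨h₁, ?_, fun i hp hi => ?_⟩,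
      fun ⟨h₁, h₂, h₃⟩ => ⟨⟨h₁, ?_, ?_⟩, ?_, ?_, fun i hp hi => ?_⟩⟩
    · simpa [hs] using h₂
    · by_cases hir : i = r
      · subst hir
        simpa [hq, hqr] using h₃ q hq hqr
      · simpa [hp, hi, hir, Equiv.swap_apply_of_ne_of_ne] using h₃ i hp hir
    · simp [hq]
    · simp +contextual
    · simp [hr, hqr.symm]
    · simpa [hs] using h₂
    · by_cases hiq : i = q
      · subst hiq
        simpa [hp] using h₃ r hr hqr.symm
      · simpa [hp, hi, hiq, Equiv.swap_apply_of_ne_of_ne] using h₃ i hp hiq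
  · intro h _ hh
    rw [ite_zero_mul_ite_zero, if_neg]
    rintro ⟨⟨-, h₂, h₃⟩, h₄, -, -⟩
    refine hh (funext fun i => ?_)
    by_cases hp : i = p
    · subst hp; simp [h₄, h₃ r hr hqr.symm]
    by_cases hi : i = q
    · subst hi; simp [hp, ← h₂, h₄, h₃ r hr hqr.symm]
    simp [hp, hi, h₃ i hp hi]
  · simp

variable (hn : 1 ≤ n)

theorem pt_V_mem_Aspan (σ : Equiv.Perm (Fin n)) : pt (lastIdx n hn) (V n d σ) ∈ Aspan n d hn :=
  Submodule.subset_span ⟨σ, rfl⟩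

theorem pt_V_mem_Mid {σ : Equiv.Perm (Fin n)} (hσ : σ (lastIdx n hn) ≠ lastIdx n hn) :
    pt (lastIdx n hn) (V n d σ) ∈ Mid n d hn :=
  Submodule.subset_span ⟨σ, hσ, rfl⟩

theorem Mid_le_Aspan : Mid n d hn ≤ Aspan n d hn := by
  refine Submodule.span_le.2 ?_
  rintro _ ⟨σ, -, rfl⟩
  exact pt_V_mem_Aspan hn σ

theorem pt_V_mul_pt_V_mem_Mid {σ τ : Equiv.Perm (Fin n)}
    (h : σ (lastIdx n hn) ≠ lastIdx n hn ∨ τ (lastIdx n hn) ≠ lastIdx n hn) :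
    pt (lastIdx n hn) (V n d σ) * pt (lastIdx n hn) (V n d τ) ∈ Mid n d hn := by
  generalize hp : lastIdx n hn = p at h
  have key : ∀ {ρ : Equiv.Perm (Fin n)}, ρ p ≠ p → pt p (V n d ρ) ∈ Mid n d hn := by
    subst hp
    exact fun hρ => pt_V_mem_Mid hn hρ
  by_cases hσ : σ p = p
  · have hτ := h.resolve_left (not_not_intro hσ)
    rw [pt_V_of_fixed hσ, ← pt_V_mul_of_fixed_left hσ]
    exact key fun e => hτ (σ.injective (e.trans hσ.symm))
  by_cases hτ : τ p = p
  · rw [pt_V_of_fixed hτ, ← pt_V_mul_of_fixed_right hτ]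
    exact key (by simpa [hτ] using hσ)
  set q := σ.symm p with hq
  set r := τ p with hr
  have hqp : q ≠ p := fun e => hσ ((Equiv.symm_apply_eq σ).1 e).symm
  obtain ⟨α, hα, hσα⟩ : ∃ α : Equiv.Perm (Fin n), α p = p ∧ σ = α * Equiv.swap p q :=
    ⟨σ * Equiv.swap p q, by simp [hq], by simp [mul_assoc]⟩
  obtain ⟨β, hβ, hτβ⟩ : ∃ β : Equiv.Perm (Fin n), β p = p ∧ τ = Equiv.swap p r * β :=
    ⟨Equiv.swap p r * τ, by simp [← hr], by simp [← mul_assoc]⟩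
  rw [hσα, hτβ, pt_V_mul_of_fixed_left hα, pt_V_mul_of_fixed_right hβ, mul_assoc,
    ← mul_assoc (pt p _)]
  by_cases hqr : q = r
  · rw [← hqr, pt_V_swap_mul_self hqp, Matrix.smul_mul, Matrix.mul_smul,
      ← pt_V_mul_of_fixed_right hβ, ← pt_V_mul_of_fixed_left hα]
    refine Submodule.smul_mem _ _ (key fun e => hqp ?_)
    simpa [hβ] using α.injective (e.trans hα.symm)
  · have hs : Equiv.swap q r p = p := Equiv.swap_apply_of_ne_of_ne (Ne.symm hqp) (Ne.symm hτ)
    rw [pt_V_swap_mul_swap hqp hτ hqr, ← pt_V_mul_of_fixed_right hs,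
      ← pt_V_mul_of_fixed_right hβ, ← pt_V_mul_of_fixed_left hα]
    refine key fun e => hqp ?_
    simpa [hβ, hs] using α.injective (e.trans hα.symm)

theorem pt_V_mul_pt_V_mem_Aspan (σ τ : Equiv.Perm (Fin n)) :
    pt (lastIdx n hn) (V n d σ) * pt (lastIdx n hn) (V n d τ) ∈ Aspan n d hn := by
  by_cases hσ : σ (lastIdx n hn) = lastIdx n hn
  · rw [pt_V_of_fixed hσ, ← pt_V_mul_of_fixed_left hσ]
    exact pt_V_mem_Aspan hn _
  · exact Mid_le_Aspan hn (pt_V_mul_pt_V_mem_Mid hn (Or.inl hσ))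

theorem mul_mem_Aspan {x y : Matrix (Fin n → Fin d) (Fin n → Fin d) ℂ}
    (hx : x ∈ Aspan n d hn) (hy : y ∈ Aspan n d hn) : x * y ∈ Aspan n d hn := by
  refine (Submodule.span_mul_span ℂ _ _).trans_le (Submodule.span_le.2 ?_)
    (Submodule.mul_mem_mul hx hy)
  rintro _ ⟨_, ⟨σ, rfl⟩, _, ⟨τ, rfl⟩, rfl⟩
  exact pt_V_mul_pt_V_mem_Aspan hn σ τ

theorem mul_mem_Mid_left {x m : Matrix (Fin n → Fin d) (Fin n → Fin d) ℂ}
    (hx : x ∈ Aspan n d hn) (hm : m ∈ Mid n d hn) : x * m ∈ Mid n d hn := by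
  refine (Submodule.span_mul_span ℂ _ _).trans_le (Submodule.span_le.2 ?_)
    (Submodule.mul_mem_mul hx hm)
  rintro _ ⟨_, ⟨σ, rfl⟩, _, ⟨τ, hτ, rfl⟩, rfl⟩
  exact pt_V_mul_pt_V_mem_Mid hn (Or.inr hτ)

theorem mul_mem_Mid_right {x m : Matrix (Fin n → Fin d) (Fin n → Fin d) ℂ}
    (hm : m ∈ Mid n d hn) (hx : x ∈ Aspan n d hn) : m * x ∈ Mid n d hn := by
  refine (Submodule.span_mul_span ℂ _ _).trans_le (Submodule.span_le.2 ?_)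
    (Submodule.mul_mem_mul hm hx)
  rintro _ ⟨_, ⟨σ, hσ, rfl⟩, _, ⟨τ, rfl⟩, rfl⟩
  exact pt_V_mul_pt_V_mem_Mid hn (Or.inl hσ)

theorem conjTranspose_mem_Mid {m : Matrix (Fin n → Fin d) (Fin n → Fin d) ℂ}
    (hm : m ∈ Mid n d hn) : m.conjTranspose ∈ Mid n d hn := by
  induction hm using Submodule.span_induction with
  | mem x hx =>
    obtain ⟨σ, hσ, rfl⟩ := hx
    rw [conjTranspose_pt_V]
    exact pt_V_mem_Mid hn fun e => hσ (Equiv.Perm.inv_eq_iff_eq.1 e).symm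
  | zero => simp
  | add x y _ _ hx hy => simpa using add_mem hx hy
  | smul c x _ hx => simpa using Submodule.smul_mem _ _ hx

end PartialTranspose

/-- The bilinear form `(x, y) ↦ tr (x y)` on square matrices. -/
noncomputable def traceMulForm (ι : Type*) [Fintype ι] :
    LinearMap.BilinForm ℂ (Matrix ι ι ℂ) :=
  (LinearMap.mul ℂ (Matrix ι ι ℂ)).compr₂ (Matrix.traceLinearMap ι ℂ ℂ)

theorem traceMulForm_apply {ι : Type*} [Fintype ι] (x y : Matrix ι ι ℂ) :
    traceMulForm ι x y = (x * y).trace := rfl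

theorem traceMulForm_isRefl (ι : Type*) [Fintype ι] : (traceMulForm ι).IsRefl := by
  intro x y h
  rwa [traceMulForm_apply, Matrix.trace_mul_comm] at h

/-- There is a two-sided ideal `S` of `A_n^{t_n}(d)` with `A_n^{t_n}(d) = M ⊕ S`
(internal direct sum) and `M·S = 0 = S·M`. -/
theorem exists_complementary_ideal (n d : ℕ) (hn : 1 ≤ n) (hd : 1 ≤ d) :
    ∃ S : Submodule ℂ (Matrix (Fin n → Fin d) (Fin n → Fin d) ℂ),
      S ≤ Aspan n d hn ∧
      (∀ x ∈ Aspan n d hn, ∀ s ∈ S, x * s ∈ S ∧ s * x ∈ S) ∧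
      Mid n d hn ⊔ S = Aspan n d hn ∧
      Mid n d hn ⊓ S = ⊥ ∧
      (∀ m ∈ Mid n d hn, ∀ s ∈ S, m * s = 0 ∧ s * m = 0) := by
  let B := traceMulForm (Fin n → Fin d)
  have hdisj : Disjoint (Mid n d hn) (B.orthogonal (Mid n d hn)) := by
    refine Submodule.disjoint_def.2 fun m hm ho => ?_
    open ComplexOrder in
    exact Matrix.trace_conjTranspose_mul_self_eq_zero_iff.1
      (ho _ (conjTranspose_mem_Mid hn hm))
  have hcompl : IsCompl (Mid n d hn) (B.orthogonal (Mid n d hn)) :=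
    (LinearMap.BilinForm.isCompl_orthogonal_iff_disjoint (traceMulForm_isRefl _)).2 hdisj
  have hideal : ∀ x ∈ Aspan n d hn, ∀ s ∈ B.orthogonal (Mid n d hn) ⊓ Aspan n d hn,
      x * s ∈ B.orthogonal (Mid n d hn) ⊓ Aspan n d hn ∧
        s * x ∈ B.orthogonal (Mid n d hn) ⊓ Aspan n d hn := by
    rintro x hx s ⟨hs, hsA⟩
    refine ⟨⟨fun m hm => ?_, mul_mem_Aspan hn hx hsA⟩,
      ⟨fun m hm => ?_, mul_mem_Aspan hn hsA hx⟩⟩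
    · change (m * (x * s)).trace = 0
      rw [← mul_assoc]
      exact hs _ (mul_mem_Mid_right hn hm hx)
    · change (m * (s * x)).trace = 0
      rw [← mul_assoc, Matrix.trace_mul_comm, ← mul_assoc]
      exact hs _ (mul_mem_Mid_left hn hx hm)
  refine ⟨B.orthogonal (Mid n d hn) ⊓ Aspan n d hn, inf_le_right, hideal, ?_, ?_, ?_⟩
  · rw [← sup_inf_assoc_of_le _ (Mid_le_Aspan hn), hcompl.sup_eq_top, top_inf_eq]
  · rw [← inf_assoc, hdisj.eq_bot, bot_inf_eq]
  · rintro m hm s hs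
    obtain ⟨h₁, h₂⟩ := hideal m (Mid_le_Aspan hn hm) s hs
    exact ⟨Submodule.disjoint_def.1 hdisj _ (mul_mem_Mid_right hn hm hs.2) h₁.1,
      Submodule.disjoint_def.1 hdisj _ (mul_mem_Mid_left hn hs.2 hm) h₂.1⟩
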